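/- arXiv:2512.11937 — 2 statements merged into one kernel-verified Lean document; each statement's English description precedes it below -/
import Mathlib

section
/- Fix 0 < q < 1, let r,s,t ∈ ℕ, let α₁,α₂,β₁,β₂,γ₁,γ₂,γ₃,λ₁,λ₂,μ₁,μ₂,μ₃ be complex parameters and δ₁,δ₂,δ₃ ∈ ℂ, such that all q-shifted factorials occurring in denominators below are nonzero. Then Ψ(q^{α₁}, q^{β₂}; q^{γ₁}, q^{γ₂}, q^{γ₃}; r,s,t) = Σ_{i=0}^r Σ_{j=0}^s Σ_{k=0}^t w₁(i,r;q) w₂(j,s;q) w₃(k,t;q) · Ψ(q^{λ₁}, q^{λ₂}; q^{μ₁}, q^{μ₂}, q^{μ₃}; i,j,k), where for parameters C₁,C₂,D₁,D₂,D₃ and nonnegative integers N₁,N₂,N₃, Ψ(C₁,C₂; D₁,D₂,D₃; N₁,N₂,N₃) = Σ_{m=0}^{N₁} Σ_{n=0}^{N₂} Σ_{p=0}^{N₃} (q^{α₂};q)_{n+p} (q^{β₁};q)_{p+m} (C₁;q)_m (q^{-N₁};q)_m (C₂;q)_n (q^{-N₂};q)_n (q^{-N₃};q)_p q^{m+n+p}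 / ((D₁,δ₁,q;q)_m (D₂,δ₂,q;q)_n (D₃,δ₃,q;q)_p), and the weights are w₁(i,r;q) = ((q^{α₁},q;q)_r/((q^{γ₁},q^{λ₁};q)_r)) ((q^{γ₁+λ₁-α₁-μ₁};q)_{r-i}/(q;q)_{r-i}) ((q^{μ₁};q)_i/(q;q)_i) q^{(r-i)μ₁} ₃φ₂[q^{λ₁-α₁}, q^{γ₁-α₁}, q^{i-r}; q^{γ₁+λ₁-α₁-μ₁}, q^{1-r-α₁}; q, q^{1-i-μ₁}], w₂(j,s;q) = ((q^{β₂},q;q)_s/((q^{γ₂},q^{λ₂};q)_s)) ((q^{γ₂+λ₂-β₂-μ₂};q)_{s-j}/(q;q)_{s-j}) ((q^{μ₂};q)_j/(q;q)_j) q^{(s-j)μ₂} ₃φ₂[q^{λ₂-β₂}, q^{γ₂-β₂}, q^{j-s}; q^{γ₂+λ₂-β₂-μ₂}, q^{1-s-β₂}; q, q^{1-j-μ₂}], and w₃(k,t;q) = ((q;q)_t/(q^{γ₃};q)_t) ((q^{γ₃-μ₃};q)_{t-k}/(q;q)_{t-k}) ((q^{μ₃};q)_k/(q;q)_k) q^{(t-k)μ₃}.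 -/
open Complex

noncomputable section

/-- Finite q-shifted factorial `(a;q)ₙ`. -/
def qPoch (q a : ℂ) (n : ℕ) : ℂ := ∏ j ∈ Finset.range n, (1 - a * q ^ j)

/-- Infinite q-shifted factorial `(a;q)_∞`. -/
def qPochInf (q a : ℂ) : ℂ := ∏' j : ℕ, (1 - a * q ^ j)

/-- Jackson q-integral `∫₀¹ f(t) d_q t = (1-q) Σ_{n≥0} f(qⁿ) qⁿ`. -/
def qInt (q : ℝ) (f : ℝ → ℂ) : ℂ :=
  ((1 - q : ℝ) : ℂ) * ∑' n : ℕ, f (q ^ n) * (q : ℂ) ^ n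

/-- Three-dimensional Jackson q-integral over `[0,1]³`. -/
def qInt3 (q : ℝ) (f : ℝ → ℝ → ℝ → ℂ) : ℂ :=
  ((1 - q : ℝ) : ℂ) ^ 3 *
    ∑' (n₁ : ℕ) (n₂ : ℕ) (n₃ : ℕ),
      f (q ^ n₁) (q ^ n₂) (q ^ n₃) * (q : ℂ) ^ (n₁ + n₂ + n₃)

/-- The q-gamma function `Γ_q(x)`. -/
def qGammaC (q : ℝ) (x : ℂ) : ℂ :=
  qPochInf (q : ℂ) (q : ℂ) / qPochInf (q : ℂ) ((q : ℂ) ^ x) * ((1 - q : ℝ) : ℂ) ^ (1 - x)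

/-- Basic hypergeometric series `₂φ₁[a,b;c;q,w]`. -/
def phi21 (q a b c w : ℂ) : ℂ :=
  ∑' n : ℕ, qPoch q a n * qPoch q b n / (qPoch q c n * qPoch q q n) * w ^ n

/-- Basic hypergeometric series `₃φ₂[a,b,c;d,e;q,w]`. -/
def phi32 (q a b c d e w : ℂ) : ℂ :=
  ∑' n : ℕ,
    qPoch q a n * qPoch q b n * qPoch q c n /
      (qPoch q d n * qPoch q e n * qPoch q q n) * w ^ n

/-- Basic hypergeometric series `₃φ₁[a,b,c;e;q,w]`. -/
def phi31 (q a b c e w : ℂ) : ℂ :=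
  ∑' n : ℕ,
    qPoch q a n * qPoch q b n * qPoch q c n / (qPoch q e n * qPoch q q n) *
      ((-1 : ℂ) ^ n * q ^ n.choose 2)⁻¹ * w ^ n

/-- Density of the q-Dirichlet measure `dμ_{α,β}(t;q)` (without the `d_q t`). -/
def qDirDens (q : ℝ) (α β : ℂ) (t : ℝ) : ℂ :=
  qGammaC q (α + β) / (qGammaC q α * qGammaC q β) * (t : ℂ) ^ (α - 1) *
    (qPochInf (q : ℂ) ((t : ℂ) * q) / qPochInf (q : ℂ) ((t : ℂ) * (q : ℂ) ^ β))

/-- Density of the q-hypergeometric measure `dμ_{α,β,γ,η}(t;q)`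
(without the `d_q t`). -/
def qHypDens (q : ℝ) (α β γ η : ℂ) (t : ℝ) : ℂ :=
  qGammaC q (η + γ - α) * qGammaC q (η + γ - β) /
      (qGammaC q η * qGammaC q γ * qGammaC q (η + γ - α - β)) *
    (t : ℂ) ^ (η - 1) *
    (qPochInf (q : ℂ) ((t : ℂ) * q) / qPochInf (q : ℂ) ((t : ℂ) * (q : ℂ) ^ γ)) *
    phi31 (q : ℂ) ((q : ℂ) ^ α) ((q : ℂ) ^ β) ((t : ℂ)⁻¹) ((q : ℂ) ^ γ)
      ((t : ℂ) * (q : ℂ) ^ (γ - α - β))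

/-- The q-analogue `Φ_K[a₁,a₂,a₂,b₁,b₂,b₁;c₁,c₂,c₃;q,x,y,z]` of Saran's `F_K`. -/
def qFK (q a₁ a₂ b₁ b₂ c₁ c₂ c₃ x y z : ℂ) : ℂ :=
  ∑' (m : ℕ) (n : ℕ) (p : ℕ),
    qPoch q a₁ m * qPoch q a₂ (n + p) * qPoch q b₁ (m + p) * qPoch q b₂ n /
      (qPoch q c₁ m * qPoch q q m * qPoch q c₂ n * qPoch q q n *
        qPoch q c₃ p * qPoch q q p) * x ^ m * y ^ n * z ^ p

/-- `Φ̃_K`: the q-Saran function with every parameter `a` replaced by `q^a`. -/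
def qFKt (q : ℝ) (a₁ a₂ b₁ b₂ c₁ c₂ c₃ x y z : ℂ) : ℂ :=
  qFK (q : ℂ) ((q : ℂ) ^ a₁) ((q : ℂ) ^ a₂) ((q : ℂ) ^ b₁) ((q : ℂ) ^ b₂)
    ((q : ℂ) ^ c₁) ((q : ℂ) ^ c₂) ((q : ℂ) ^ c₃) x y z

/-- The terminating triple sum `Ψ(C₁,C₂;D₁,D₂,D₃;N₁,N₂,N₃)` of Theorem 4.4
(with fixed background parameters `q^{α₂}`, `q^{β₁}`, `δ₁`, `δ₂`, `δ₃`). -/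
def Psi (q A₂ B₁ δ₁ δ₂ δ₃ C₁ C₂ D₁ D₂ D₃ : ℂ) (N₁ N₂ N₃ : ℕ) : ℂ :=
  ∑ m ∈ Finset.range (N₁ + 1), ∑ n ∈ Finset.range (N₂ + 1),
    ∑ p ∈ Finset.range (N₃ + 1),
      qPoch q A₂ (n + p) * qPoch q B₁ (p + m) *
        qPoch q C₁ m * qPoch q (q ^ (-(N₁ : ℂ))) m *
        qPoch q C₂ n * qPoch q (q ^ (-(N₂ : ℂ))) n *
        qPoch q (q ^ (-(N₃ : ℂ))) p * q ^ (m + n + p) /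
        (qPoch q D₁ m * qPoch q δ₁ m * qPoch q q m *
          qPoch q D₂ n * qPoch q δ₂ n * qPoch q q n *
          qPoch q D₃ p * qPoch q δ₃ p * qPoch q q p)

/-- The weight `w₁(i,r;q)` (and, with other parameters, `w₂(j,s;q)`). -/
def wgt (q a g l m : ℂ) (i r : ℕ) : ℂ :=
  qPoch q (q ^ a) r * qPoch q q r / (qPoch q (q ^ g) r * qPoch q (q ^ l) r) *
    (qPoch q (q ^ (g + l - a - m)) (r - i) / qPoch q q (r - i)) *
    (qPoch q (q ^ m) i / qPoch q q i) * q ^ (((r - i : ℕ) : ℂ) * m) *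
    phi32 q (q ^ (l - a)) (q ^ (g - a)) (q ^ ((i : ℂ) - (r : ℂ)))
      (q ^ (g + l - a - m)) (q ^ (1 - (r : ℂ) - a)) (q ^ (1 - (i : ℂ) - m))

/-- The weight `w₃(k,t;q)`. -/
def wgt3 (q g m : ℂ) (k t : ℕ) : ℂ :=
  qPoch q q t / qPoch q (q ^ g) t *
    (qPoch q (q ^ (g - m)) (t - k) / qPoch q q (t - k)) *
    (qPoch q (q ^ m) k / qPoch q q k) * q ^ (((t - k : ℕ) : ℂ) * m)

lemma qPoch_zero (q a : ℂ) : qPoch q a 0 = 1 := by simp [qPoch]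

lemma qPoch_succ (q a : ℂ) (n : ℕ) : qPoch q a (n + 1) = qPoch q a n * (1 - a * q ^ n) := by
  simp [qPoch, Finset.prod_range_succ]

lemma qPoch_add (q a : ℂ) (m n : ℕ) :
    qPoch q a (m + n) = qPoch q a m * qPoch q (a * q ^ m) n := by
  simp only [qPoch, Finset.prod_range_add]
  congr 1
  exact Finset.prod_congr rfl fun j _ => by ring

lemma qPoch_succ_left (q a : ℂ) (n : ℕ) :
    qPoch q a (n + 1) = (1 - a) * qPoch q (a * q) n := by
  rw [add_comm, qPoch_add]
  simp [qPoch]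

lemma qPoch_one_succ (q : ℂ) (n : ℕ) : qPoch q 1 (n + 1) = 0 := by
  simp [qPoch_succ_left]

/-- A `q`-shifted factorial vanishes as soon as it contains a zero factor. -/
lemma qPoch_eq_zero {q b : ℂ} {N n : ℕ} (hb : b * q ^ N = 1) (h : N < n) : qPoch q b n = 0 :=
  Finset.prod_eq_zero (Finset.mem_range.2 h) (by rw [hb, sub_self])

/-- Reversal of the order of the factors in a `q`-shifted factorial. -/
lemma qPoch_mul_qPoch_sub {q : ℂ} (hq : q ≠ 0) {A c : ℂ} {R : ℕ} (hc : c * A * q ^ R = q)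
    {n : ℕ} (hn : n ≤ R) :
    qPoch q c n * qPoch q A (R - n) =
      c ^ n * (∏ j ∈ Finset.range n, -q ^ j) * qPoch q A R := by
  induction n with
  | zero => simp [qPoch_zero]
  | succ n ih =>
    obtain ⟨d, rfl⟩ := Nat.exists_eq_add_of_le hn
    have ih := ih (by omega)
    rw [show n + 1 + d - n = d + 1 by omega, qPoch_succ] at ih
    rw [show n + 1 + d - (n + 1) = d by omega, qPoch_succ, pow_succ, Finset.prod_range_succ]
    have h : c * A * q ^ n * q ^ d = 1 := by
      apply mul_right_cancel₀ hq
      linear_combination hc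
    linear_combination (c * -q ^ n) * ih - qPoch q c n * qPoch q A d * h

/-- The `q`-Pfaff–Saalschütz sum, with the denominators cleared. -/
lemma qSaalschutz {q : ℂ} (hqq : ∀ n, qPoch q q n ≠ 0) (A x y : ℂ) (R : ℕ) :
    ∑ n ∈ Finset.range (R + 1), qPoch q x n * qPoch q y n * A ^ n * qPoch q A (R - n) /
        qPoch q q n * (qPoch q (A * x * y * q ^ n) (R - n) / qPoch q q (R - n)) =
      qPoch q (A * x) R * qPoch q (A * y) R / qPoch q q R := by
  have hne (n : ℕ) : 1 - q * q ^ n ≠ 0 := fun h => hqq (n + 1) (by rw [qPoch_succ, h, mul_zero])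
  induction R with
  | zero => simp [qPoch_zero]
  | succ R ih =>
    set F : ℕ → ℕ → ℂ := fun R n => qPoch q x n * qPoch q y n * A ^ n * qPoch q A (R - n) /
        qPoch q q n * (qPoch q (A * x * y * q ^ n) (R - n) / qPoch q q (R - n)) with hF
    set H : ℕ → ℂ := fun n => q ^ (R - n) * (1 - x * q ^ n) * (1 - y * q ^ n) * A * F R n with hH
    have hzero : (1 - q * q ^ R) * F (R + 1) 0 =
        (1 - A * x * q ^ R) * (1 - A * y * q ^ R) * F R 0 - H 0 := by
      simp only [hF, hH, qPoch_zero, Nat.sub_zero, qPoch_succ, pow_zero, mul_one]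
      have := hqq R
      have := hne R
      field_simp
      ring
    have hstep (n : ℕ) (hn : n < R) : (1 - q * q ^ R) * F (R + 1) (n + 1) =
        (1 - A * x * q ^ R) * (1 - A * y * q ^ R) * F R (n + 1) - (H (n + 1) - H n) := by
      obtain ⟨d, rfl⟩ := Nat.exists_eq_add_of_lt hn
      simp only [hF, hH]
      rw [show n + d + 1 + 1 - (n + 1) = d + 1 by omega, show n + d + 1 - (n + 1) = d by omega,
        show n + d + 1 - n = d + 1 by omega, qPoch_succ_left q (A * x * y * q ^ n) d,
        show A * x * y * q ^ n * q = A * x * y * q ^ (n + 1) by ring]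
      simp only [qPoch_succ]
      have := hqq n
      have := hqq d
      have := hne n
      have := hne d
      generalize qPoch q (A * x * y * q ^ (n + 1)) d = P
      field_simp
      ring
    have hlast : (1 - q * q ^ R) * F (R + 1) (R + 1) = H R := by
      simp only [hF, hH, Nat.sub_self, qPoch_zero, qPoch_succ, pow_succ]
      have := hqq R
      have := hne R
      field_simp
    have hsum : (1 - q * q ^ R) * ∑ n ∈ Finset.range (R + 1 + 1), F (R + 1) n =
        (1 - A * x * q ^ R) * (1 - A * y * q ^ R) * ∑ n ∈ Finset.range (R + 1), F R n := by
      rw [Finset.sum_range_succ, Finset.sum_range_succ', Finset.sum_range_succ' (F R), mul_add,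
        mul_add, hlast, hzero, Finset.mul_sum,
        Finset.sum_congr rfl fun n hn => hstep n (Finset.mem_range.1 hn),
        Finset.sum_sub_distrib, Finset.sum_range_sub, ← Finset.mul_sum]
      ring
    rw [ih] at hsum
    apply mul_left_cancel₀ (hne R)
    rw [hsum]
    simp only [qPoch_succ]
    rw [mul_div_assoc', mul_div_assoc', div_eq_div_iff (hqq R) (mul_ne_zero (hqq R) (hne R))]
    ring

/-- The `q`-Chu–Vandermonde sum. -/
lemma qVandermonde {q : ℂ} (hqq : ∀ n, qPoch q q n ≠ 0) (a b : ℂ) (S : ℕ) :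
    ∑ k ∈ Finset.range (S + 1), qPoch q a k / qPoch q q k *
        (qPoch q b (S - k) * a ^ (S - k) / qPoch q q (S - k)) =
      qPoch q (a * b) S / qPoch q q S := by
  have h := qSaalschutz hqq a b 0 S
  have h0 (n : ℕ) : qPoch q 0 n = 1 := by simp [qPoch]
  simp only [mul_zero, zero_mul, h0, mul_one] at h
  rw [← h, ← Finset.sum_range_reflect]
  refine Finset.sum_congr rfl fun n hn => ?_
  have hn := Finset.mem_range.1 hn
  rw [show S + 1 - 1 - n = S - n by omega, show S - (S - n) = n by omega]
  ring

/-- The connection coefficients, with the terminating series rewritten so that only `q`-shifted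
factorials of `q` remain in the denominators of its terms. -/
def qWeight (q A x y M X : ℂ) (i r : ℕ) : ℂ :=
  qPoch q q r / (qPoch q (A * y) r * qPoch q (A * x) r) * (qPoch q M i / qPoch q q i) *
    ∑ n ∈ Finset.range (r - i + 1), qPoch q x n * qPoch q y n * A ^ n * qPoch q A (r - n) /
      qPoch q q n * (qPoch q (X * q ^ n) (r - i - n) * M ^ (r - i - n) / qPoch q q (r - i - n))

lemma sum_sum_qPoch {q : ℂ} (hqq : ∀ n, qPoch q q n ≠ 0) (A x y M X : ℂ)
    (hX : M * X = A * x * y) (R : ℕ) :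
    ∑ k ∈ Finset.range (R + 1), qPoch q M k / qPoch q q k *
      ∑ n ∈ Finset.range (R - k + 1), qPoch q x n * qPoch q y n * A ^ n * qPoch q A (R - n) /
        qPoch q q n *
          (qPoch q (X * q ^ n) (R - k - n) * M ^ (R - k - n) / qPoch q q (R - k - n)) =
      qPoch q (A * x) R * qPoch q (A * y) R / qPoch q q R := by
  rw [← qSaalschutz hqq]
  simp only [Finset.mul_sum]
  rw [Finset.sum_comm' (s' := fun n => Finset.range (R - n + 1)) (t' := Finset.range (R + 1))
    (by intro k n; simp only [Finset.mem_range]; omega)]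
  refine Finset.sum_congr rfl fun n _ => ?_
  rw [← hX, mul_assoc M, ← qVandermonde hqq, Finset.mul_sum]
  refine Finset.sum_congr rfl fun k _ => ?_
  rw [Nat.sub_right_comm]
  ring

lemma sum_qWeight {q : ℂ} (hq : q ≠ 0) (hqq : ∀ n, qPoch q q n ≠ 0) {A x y M X : ℂ}
    (hX : M * X = A * x * y) (hM : ∀ n, qPoch q M n ≠ 0) (hG : ∀ n, qPoch q (A * y) n ≠ 0)
    (hL : ∀ n, qPoch q (A * x) n ≠ 0) {m r : ℕ} (hm : m ≤ r) :
    ∑ i ∈ Finset.range (r + 1), qWeight q A x y M X i r *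
        (qPoch q (A * x) m * qPoch q (q ^ i)⁻¹ m / qPoch q M m) =
      qPoch q A m * qPoch q (q ^ r)⁻¹ m / qPoch q (A * y) m := by
  obtain ⟨R, rfl⟩ := Nat.exists_eq_add_of_le hm
  have hrev (i : ℕ) : qPoch q (q ^ (m + i))⁻¹ m =
      (q ^ (m + i))⁻¹ ^ m * (∏ j ∈ Finset.range m, -q ^ j) * qPoch q q (m + i) / qPoch q q i := by
    rw [eq_div_iff (hqq i), ← qPoch_mul_qPoch_sub hq _ (Nat.le_add_right m i),
      Nat.add_sub_cancel_left]
    field_simp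
  rw [add_assoc, Finset.sum_range_add, Finset.sum_eq_zero (s := Finset.range m), zero_add]
  swap
  · intro i hi
    rw [qPoch_eq_zero (b := (q ^ i)⁻¹) (inv_mul_cancel₀ (pow_ne_zero i hq))
      (Finset.mem_range.1 hi)]
    simp
  have key := sum_sum_qPoch hqq (A * q ^ m) x y (M * q ^ m) X (by linear_combination q ^ m * hX) R
  have hterm (k : ℕ) (hk : k ∈ Finset.range (R + 1)) :
      qWeight q A x y M X (m + k) (m + R) *
        (qPoch q (A * x) m * qPoch q (q ^ (m + k))⁻¹ m / qPoch q M m) =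
      qPoch q q (m + R) / (qPoch q (A * y) (m + R) * qPoch q (A * x) (m + R)) *
        qPoch q (A * x) m * qPoch q A m * (q ^ (m + R))⁻¹ ^ m *
        (∏ j ∈ Finset.range m, -q ^ j) * (qPoch q (M * q ^ m) k / qPoch q q k *
      ∑ n ∈ Finset.range (R - k + 1), qPoch q x n * qPoch q y n * (A * q ^ m) ^ n *
        qPoch q (A * q ^ m) (R - n) / qPoch q q n *
          (qPoch q (X * q ^ n) (R - k - n) * (M * q ^ m) ^ (R - k - n) /
            qPoch q q (R - k - n))) := by
    rw [hrev, qWeight, qPoch_add q M, Nat.add_sub_add_left]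
    simp only [Finset.mul_sum, Finset.sum_mul]
    refine Finset.sum_congr rfl fun n hn => ?_
    simp only [Finset.mem_range] at hk hn
    obtain ⟨d, rfl⟩ : ∃ d, R = k + n + d := ⟨R - k - n, by omega⟩
    rw [show m + (k + n + d) - n = m + (k + d) by omega, show k + n + d - n = k + d by omega,
      show k + n + d - k - n = d by omega, qPoch_add q A]
    have hpow : (q ^ (m + k))⁻¹ ^ m =
        (q ^ (m + (k + n + d)))⁻¹ ^ m * (q ^ m) ^ n * (q ^ m) ^ d := by
      simp only [inv_pow]
      field_simp
      ring
    rw [hpow, mul_pow A, mul_pow M]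
    have hMm : qPoch q M m * (qPoch q M m)⁻¹ = 1 := mul_inv_cancel₀ (hM m)
    have hqk : qPoch q q (m + k) * (qPoch q q (m + k))⁻¹ = 1 := mul_inv_cancel₀ (hqq (m + k))
    generalize (q ^ (m + (k + n + d)))⁻¹ ^ m = u
    simp only [div_eq_mul_inv, mul_inv]
    generalize (qPoch q M m)⁻¹ = v at *
    generalize (qPoch q q (m + k))⁻¹ = w at *
    grind
  rw [Finset.sum_congr rfl hterm, ← Finset.mul_sum, key, hrev, qPoch_add q (A * y),
    qPoch_add q (A * x)]
  have h₁ := hG (m + R)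
  have h₂ := hL (m + R)
  rw [qPoch_add] at h₁ h₂
  have := left_ne_zero_of_mul h₁
  have := right_ne_zero_of_mul h₁
  have := left_ne_zero_of_mul h₂
  have := right_ne_zero_of_mul h₂
  rw [show A * q ^ m * x = A * x * q ^ m by ring, show A * q ^ m * y = A * y * q ^ m by ring]
  generalize qPoch q (A * y * q ^ m) R = g at *
  generalize qPoch q (A * x * q ^ m) R = l at *
  field_simp

lemma phi32_eq_sum {q b : ℂ} {N : ℕ} (hb : b * q ^ N = 1) (x y d e w : ℂ) :
    phi32 q x y b d e w = ∑ n ∈ Finset.range (N + 1),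
      qPoch q x n * qPoch q y n * qPoch q b n /
        (qPoch q d n * qPoch q e n * qPoch q q n) * w ^ n :=
  tsum_eq_sum fun n hn => by
    rw [qPoch_eq_zero hb (by simpa using hn)]
    simp

lemma wgt_eq_qWeight {q : ℂ} (hq : q ≠ 0) (hqq : ∀ n, qPoch q q n ≠ 0) {a g l m : ℂ} {r : ℕ}
    (hX : ∀ n, qPoch q (q ^ (g + l - a - m)) n ≠ 0)
    (hc : ∀ n, qPoch q (q ^ (1 - (r : ℂ) - a)) n ≠ 0) {i : ℕ} (hi : i ≤ r) :
    wgt q a g l m i r =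
      qWeight q (q ^ a) (q ^ (l - a)) (q ^ (g - a)) (q ^ m) (q ^ (g + l - a - m)) i r := by
  obtain ⟨N, rfl⟩ := Nat.exists_eq_add_of_le hi
  have ha : q ^ a ≠ 0 := by simp [Complex.cpow_eq_zero_iff, hq]
  have hm : q ^ m ≠ 0 := by simp [Complex.cpow_eq_zero_iff, hq]
  have hb : q ^ ((i : ℂ) - ((i + N : ℕ) : ℂ)) = (q ^ N)⁻¹ := by
    rw [← Complex.cpow_natCast q N, ← Complex.cpow_neg]
    push_cast
    ring_nf
  have hcA : q ^ (1 - ((i + N : ℕ) : ℂ) - a) = q / (q ^ (i + N) * q ^ a) := by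
    rw [sub_sub, Complex.cpow_sub _ _ hq, Complex.cpow_add _ _ hq, Complex.cpow_one,
      Complex.cpow_natCast]
  have hz : q ^ (1 - (i : ℂ) - m) = q / (q ^ i * q ^ m) := by
    rw [sub_sub, Complex.cpow_sub _ _ hq, Complex.cpow_add _ _ hq, Complex.cpow_one,
      Complex.cpow_natCast]
  rw [wgt, qWeight, hb, phi32_eq_sum (N := N) (inv_mul_cancel₀ (pow_ne_zero N hq)),
    Nat.add_sub_cancel_left, ← Complex.cpow_add _ _ hq, ← Complex.cpow_add _ _ hq,
    add_sub_cancel, add_sub_cancel, Complex.cpow_nat_mul, hz, Finset.mul_sum, Finset.mul_sum]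
  refine Finset.sum_congr rfl fun n hn => ?_
  obtain ⟨d, rfl⟩ : ∃ d, N = n + d := ⟨N - n, by have := Finset.mem_range.1 hn; omega⟩
  have e₁ := qPoch_mul_qPoch_sub hq (A := q) (c := (q ^ (n + d))⁻¹) (R := n + d)
    (by field_simp) (Nat.le_add_right n d)
  have e₂ := qPoch_mul_qPoch_sub hq (A := q ^ a) (c := q ^ (1 - ((i + (n + d) : ℕ) : ℂ) - a))
    (R := i + (n + d)) (by rw [hcA]; field_simp) (n := n) (by omega)
  rw [Nat.add_sub_cancel_left] at e₁
  have hpow : (q ^ m) ^ n * (q ^ (n + d))⁻¹ ^ n * (q / (q ^ i * q ^ m)) ^ n =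
      (q ^ a) ^ n * (q ^ (1 - ((i + (n + d) : ℕ) : ℂ) - a)) ^ n := by
    rw [hcA, ← mul_pow, ← mul_pow, ← mul_pow]
    congr 1
    field_simp
    ring
  have hcore : qPoch q (q ^ a) (i + (n + d)) *
      (qPoch q (q ^ (g + l - a - m)) (n + d) / qPoch q q (n + d)) * (q ^ m) ^ (n + d) *
      (qPoch q (q ^ (n + d))⁻¹ n / (qPoch q (q ^ (g + l - a - m)) n *
        qPoch q (q ^ (1 - ((i + (n + d) : ℕ) : ℂ) - a)) n)) * (q / (q ^ i * q ^ m)) ^ n =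
      (q ^ a) ^ n * qPoch q (q ^ a) (i + (n + d) - n) *
        (qPoch q (q ^ (g + l - a - m) * q ^ n) d * (q ^ m) ^ d / qPoch q q d) := by
    rw [eq_div_of_mul_eq (hqq d) e₁, eq_div_of_mul_eq (hc n) ((mul_comm _ _).trans e₂),
      qPoch_add q (q ^ (g + l - a - m)), pow_add (q ^ m)]
    have h₁ := hqq d
    have h₂ := hqq (n + d)
    have h₃ := hc n
    have h₄ := hX n
    generalize qPoch q (q ^ (1 - ((i + (n + d) : ℕ) : ℂ) - a)) n = C at *
    generalize (q ^ (1 - ((i + (n + d) : ℕ) : ℂ) - a)) ^ n = D at *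
    generalize (q / (q ^ i * q ^ m)) ^ n = Z at *
    generalize (q ^ (n + d))⁻¹ ^ n = B at *
    generalize (q ^ m) ^ n = U at *
    generalize (q ^ a) ^ n = V at *
    generalize (∏ j ∈ Finset.range n, -q ^ j) = E at *
    field_simp
    linear_combination qPoch q (q ^ a) (i + (n + d)) *
      qPoch q (q ^ (g + l - a - m) * q ^ n) d * E * hpow
  rw [Nat.add_sub_cancel_left]
  linear_combination qPoch q q (i + (n + d)) /
    (qPoch q (q ^ g) (i + (n + d)) * qPoch q (q ^ l) (i + (n + d))) *
    (qPoch q (q ^ m) i / qPoch q q i) * (qPoch q (q ^ (l - a)) n * qPoch q (q ^ (g - a)) n /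
      qPoch q q n) * hcore

lemma wgt3_eq_qWeight {q g m : ℂ} {t : ℕ} (hG : qPoch q (q ^ g) t ≠ 0) (k : ℕ) :
    wgt3 q g m k t = qWeight q (q ^ g) 1 1 (q ^ m) (q ^ (g - m)) k t := by
  rw [wgt3, qWeight, Finset.sum_range_succ', Finset.sum_eq_zero fun n _ => by
    rw [qPoch_one_succ]; simp, Complex.cpow_nat_mul]
  simp only [qPoch_zero, Nat.sub_zero, mul_one, pow_zero, zero_add, one_mul, div_one]
  field_simp

lemma sum_wgt {q : ℂ} (hq : q ≠ 0) (hqq : ∀ n, qPoch q q n ≠ 0) {a g l μ : ℂ} {r : ℕ}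
    (hG : ∀ n, qPoch q (q ^ g) n ≠ 0) (hL : ∀ n, qPoch q (q ^ l) n ≠ 0)
    (hM : ∀ n, qPoch q (q ^ μ) n ≠ 0) (hX : ∀ n, qPoch q (q ^ (g + l - a - μ)) n ≠ 0)
    (hc : ∀ n, qPoch q (q ^ (1 - (r : ℂ) - a)) n ≠ 0) {m : ℕ} (hm : m ≤ r) :
    ∑ i ∈ Finset.range (r + 1), wgt q a g l μ i r *
        (qPoch q (q ^ l) m * qPoch q (q ^ (-(i : ℂ))) m / qPoch q (q ^ μ) m) =
      qPoch q (q ^ a) m * qPoch q (q ^ (-(r : ℂ))) m / qPoch q (q ^ g) m := by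
  have hl : q ^ a * q ^ (l - a) = q ^ l := by rw [← Complex.cpow_add _ _ hq, add_sub_cancel]
  have hg : q ^ a * q ^ (g - a) = q ^ g := by rw [← Complex.cpow_add _ _ hq, add_sub_cancel]
  have h := sum_qWeight hq hqq (A := q ^ a) (x := q ^ (l - a)) (y := q ^ (g - a)) (M := q ^ μ)
    (X := q ^ (g + l - a - μ))
    (by simp only [← Complex.cpow_add _ _ hq]; ring_nf) hM (by rwa [hg]) (by rwa [hl]) hm
  rw [hl, hg] at h
  simp only [Complex.cpow_neg, Complex.cpow_natCast]
  rw [← h]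
  refine Finset.sum_congr rfl fun i hi => ?_
  rw [wgt_eq_qWeight hq hqq hX hc (Nat.lt_succ_iff.1 (Finset.mem_range.1 hi))]

lemma sum_wgt3 {q : ℂ} (hq : q ≠ 0) (hqq : ∀ n, qPoch q q n ≠ 0) {g μ : ℂ} {t : ℕ}
    (hG : ∀ n, qPoch q (q ^ g) n ≠ 0) (hM : ∀ n, qPoch q (q ^ μ) n ≠ 0) {m : ℕ} (hm : m ≤ t) :
    ∑ k ∈ Finset.range (t + 1), wgt3 q g μ k t *
        (qPoch q (q ^ (-(k : ℂ))) m / qPoch q (q ^ μ) m) =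
      qPoch q (q ^ (-(t : ℂ))) m / qPoch q (q ^ g) m := by
  have h := sum_qWeight hq hqq (A := q ^ g) (x := 1) (y := 1) (M := q ^ μ) (X := q ^ (g - μ))
    (by rw [← Complex.cpow_add _ _ hq]; ring_nf) hM (by rwa [mul_one]) (by rwa [mul_one]) hm
  simp only [Complex.cpow_neg, Complex.cpow_natCast]
  apply mul_left_cancel₀ (hG m)
  simp only [mul_one, ← wgt3_eq_qWeight (hG t)] at h
  rw [← mul_div_assoc, ← h, Finset.mul_sum]
  exact Finset.sum_congr rfl fun k _ => by ring

/-- The part of the summand of `Psi` not involving the parameters that are transformed. -/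
def psiKernel (q A₂ B₁ δ₁ δ₂ δ₃ : ℂ) (m n p : ℕ) : ℂ :=
  qPoch q A₂ (n + p) * qPoch q B₁ (p + m) * q ^ (m + n + p) /
    (qPoch q δ₁ m * qPoch q q m * qPoch q δ₂ n * qPoch q q n * qPoch q δ₃ p * qPoch q q p)

/-- `Psi` in factored form, over any box containing the support of its summand. -/
lemma Psi_eq_sum {q : ℂ} (hq : q ≠ 0) (A₂ B₁ δ₁ δ₂ δ₃ C₁ C₂ D₁ D₂ D₃ : ℂ) {i j k r s t : ℕ}
    (hi : i ≤ r) (hj : j ≤ s) (hk : k ≤ t) :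
    Psi q A₂ B₁ δ₁ δ₂ δ₃ C₁ C₂ D₁ D₂ D₃ i j k =
      ∑ m ∈ Finset.range (r + 1), ∑ n ∈ Finset.range (s + 1), ∑ p ∈ Finset.range (t + 1),
        psiKernel q A₂ B₁ δ₁ δ₂ δ₃ m n p *
          (qPoch q C₁ m * qPoch q (q ^ (-(i : ℂ))) m / qPoch q D₁ m) *
          (qPoch q C₂ n * qPoch q (q ^ (-(j : ℂ))) n / qPoch q D₂ n) *
          (qPoch q (q ^ (-(k : ℂ))) p / qPoch q D₃ p) := by
  have hz {N n : ℕ} (h : n ∉ Finset.range (N + 1)) : qPoch q (q ^ (-(N : ℂ))) n = 0 :=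
    qPoch_eq_zero (N := N) (by
      rw [Complex.cpow_neg, Complex.cpow_natCast, inv_mul_cancel₀ (pow_ne_zero N hq)])
      (by simpa using h)
  have hsub {N R : ℕ} (h : N ≤ R) : Finset.range (N + 1) ⊆ Finset.range (R + 1) :=
    Finset.range_subset_range.2 (by omega)
  rw [Psi, ← Finset.sum_subset (hsub hi) fun m _ hm => by simp [hz hm]]
  refine Finset.sum_congr rfl fun m _ => ?_
  rw [← Finset.sum_subset (hsub hj) fun n _ hn => by simp [hz hn]]
  refine Finset.sum_congr rfl fun n _ => ?_
  rw [← Finset.sum_subset (hsub hk) fun p _ hp => by simp [hz hp]]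
  refine Finset.sum_congr rfl fun p _ => ?_
  simp only [psiKernel, div_eq_mul_inv, mul_inv]
  ring

/-- Interchange of summations in a triple sum whose summand contains three factors that are
themselves sums. -/
lemma sum_mul_sum_mul_sum_mul_sum {ι : Type*} (I J K I₁ J₁ K₁ : Finset ι) (f : ι → ι → ι → ℂ)
    (u v w : ι → ℂ) (a b c : ι → ι → ℂ) :
    ∑ m ∈ I₁, ∑ n ∈ J₁, ∑ p ∈ K₁,
        f m n p * (∑ i ∈ I, u i * a i m) * (∑ j ∈ J, v j * b j n) * (∑ k ∈ K, w k * c k p) =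
      ∑ i ∈ I, ∑ j ∈ J, ∑ k ∈ K, u i * v j * w k *
        ∑ m ∈ I₁, ∑ n ∈ J₁, ∑ p ∈ K₁, f m n p * a i m * b j n * c k p := by
  have h (m n p : ι) :
      f m n p * (∑ i ∈ I, u i * a i m) * (∑ j ∈ J, v j * b j n) * (∑ k ∈ K, w k * c k p) =
      ∑ i ∈ I, ∑ j ∈ J, ∑ k ∈ K, u i * v j * w k * (f m n p * a i m * b j n * c k p) := by
    rw [mul_assoc, mul_assoc, Finset.sum_mul_sum, Finset.sum_mul_sum, Finset.mul_sum]
    simp only [Finset.mul_sum]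
    exact Finset.sum_congr rfl fun i _ => Finset.sum_congr rfl fun j _ =>
      Finset.sum_congr rfl fun k _ => by ring
  have hswap (S : Finset ι) (g : ι → ι → ι → ι → ℂ) :
      ∑ x ∈ S, ∑ i ∈ I, ∑ j ∈ J, ∑ k ∈ K, g x i j k =
        ∑ i ∈ I, ∑ j ∈ J, ∑ k ∈ K, ∑ x ∈ S, g x i j k := by
    rw [Finset.sum_comm]
    refine Finset.sum_congr rfl fun i _ => ?_
    rw [Finset.sum_comm]
    exact Finset.sum_congr rfl fun j _ => Finset.sum_comm
  simp only [h]
  simp only [hswap, Finset.mul_sum]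

/-- Theorem 4.4: the discrete q-analogue of Corollary 4.3. -/
theorem discrete_qFK
    (q : ℝ) (hq0 : 0 < q) (hq1 : q < 1)
    (r s t : ℕ)
    (α₁ α₂ β₁ β₂ γ₁ γ₂ γ₃ Λ₁ Λ₂ μ₁ μ₂ μ₃ δ₁ δ₂ δ₃ : ℂ)
    (hden : ∀ n : ℕ,
      qPoch (q : ℂ) ((q : ℂ) ^ γ₁) n ≠ 0 ∧ qPoch (q : ℂ) ((q : ℂ) ^ γ₂) n ≠ 0 ∧
      qPoch (q : ℂ) ((q : ℂ) ^ γ₃) n ≠ 0 ∧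
      qPoch (q : ℂ) ((q : ℂ) ^ Λ₁) n ≠ 0 ∧ qPoch (q : ℂ) ((q : ℂ) ^ Λ₂) n ≠ 0 ∧
      qPoch (q : ℂ) ((q : ℂ) ^ μ₁) n ≠ 0 ∧ qPoch (q : ℂ) ((q : ℂ) ^ μ₂) n ≠ 0 ∧
      qPoch (q : ℂ) ((q : ℂ) ^ μ₃) n ≠ 0 ∧
      qPoch (q : ℂ) δ₁ n ≠ 0 ∧ qPoch (q : ℂ) δ₂ n ≠ 0 ∧ qPoch (q : ℂ) δ₃ n ≠ 0 ∧
      qPoch (q : ℂ) ((q : ℂ) ^ (γ₁ + Λ₁ - α₁ - μ₁)) n ≠ 0 ∧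
      qPoch (q : ℂ) ((q : ℂ) ^ (γ₂ + Λ₂ - β₂ - μ₂)) n ≠ 0 ∧
      qPoch (q : ℂ) ((q : ℂ) ^ (1 - (r : ℂ) - α₁)) n ≠ 0 ∧
      qPoch (q : ℂ) ((q : ℂ) ^ (1 - (s : ℂ) - β₂)) n ≠ 0) :
    Psi (q : ℂ) ((q : ℂ) ^ α₂) ((q : ℂ) ^ β₁) δ₁ δ₂ δ₃
        ((q : ℂ) ^ α₁) ((q : ℂ) ^ β₂) ((q : ℂ) ^ γ₁) ((q : ℂ) ^ γ₂) ((q : ℂ) ^ γ₃)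
        r s t =
      ∑ i ∈ Finset.range (r + 1), ∑ j ∈ Finset.range (s + 1),
        ∑ k ∈ Finset.range (t + 1),
          wgt (q : ℂ) α₁ γ₁ Λ₁ μ₁ i r * wgt (q : ℂ) β₂ γ₂ Λ₂ μ₂ j s *
            wgt3 (q : ℂ) γ₃ μ₃ k t *
            Psi (q : ℂ) ((q : ℂ) ^ α₂) ((q : ℂ) ^ β₁) δ₁ δ₂ δ₃
              ((q : ℂ) ^ Λ₁) ((q : ℂ) ^ Λ₂) ((q : ℂ) ^ μ₁) ((q : ℂ) ^ μ₂)
              ((q : ℂ) ^ μ₃) i j k := by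
  have hq : (q : ℂ) ≠ 0 := Complex.ofReal_ne_zero.2 hq0.ne'
  have hqq (n : ℕ) : qPoch (q : ℂ) q n ≠ 0 := by
    refine Finset.prod_ne_zero_iff.2 fun j _ => ?_
    rw [← pow_succ', sub_ne_zero]
    exact_mod_cast (pow_lt_one₀ hq0.le hq1 j.succ_ne_zero).ne'
  simp only [forall_and] at hden
  obtain ⟨hγ₁, hγ₂, hγ₃, hΛ₁, hΛ₂, hμ₁, hμ₂, hμ₃, -, -, -, hX₁, hX₂, hc₁, hc₂⟩ := hden
  rw [Psi_eq_sum hq _ _ _ _ _ _ _ _ _ _ le_rfl le_rfl le_rfl]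
  have hR {N n : ℕ} (h : n ∈ Finset.range (N + 1)) : n ≤ N :=
    Nat.lt_succ_iff.1 (Finset.mem_range.1 h)
  trans ∑ m ∈ Finset.range (r + 1), ∑ n ∈ Finset.range (s + 1), ∑ p ∈ Finset.range (t + 1),
      psiKernel q ((q : ℂ) ^ α₂) ((q : ℂ) ^ β₁) δ₁ δ₂ δ₃ m n p *
        (∑ i ∈ Finset.range (r + 1), wgt q α₁ γ₁ Λ₁ μ₁ i r *
          (qPoch q ((q : ℂ) ^ Λ₁) m * qPoch q ((q : ℂ) ^ (-(i : ℂ))) m /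
            qPoch q ((q : ℂ) ^ μ₁) m)) *
        (∑ j ∈ Finset.range (s + 1), wgt q β₂ γ₂ Λ₂ μ₂ j s *
          (qPoch q ((q : ℂ) ^ Λ₂) n * qPoch q ((q : ℂ) ^ (-(j : ℂ))) n /
            qPoch q ((q : ℂ) ^ μ₂) n)) *
        (∑ k ∈ Finset.range (t + 1), wgt3 q γ₃ μ₃ k t *
          (qPoch q ((q : ℂ) ^ (-(k : ℂ))) p / qPoch q ((q : ℂ) ^ μ₃) p))
  · refine Finset.sum_congr rfl fun m hm => Finset.sum_congr rfl fun n hn =>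
      Finset.sum_congr rfl fun p hp => ?_
    rw [sum_wgt hq hqq hγ₁ hΛ₁ hμ₁ hX₁ hc₁ (hR hm), sum_wgt hq hqq hγ₂ hΛ₂ hμ₂ hX₂ hc₂ (hR hn),
      sum_wgt3 hq hqq hγ₃ hμ₃ (hR hp)]
  · rw [sum_mul_sum_mul_sum_mul_sum]
    refine Finset.sum_congr rfl fun i hi => Finset.sum_congr rfl fun j hj =>
      Finset.sum_congr rfl fun k hk => ?_
    rw [Psi_eq_sum hq _ _ _ _ _ _ _ _ _ _ (hR hi) (hR hj) (hR hk)]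
end
end

section
/- Fix 0 < q < 1 and let α₁,β₂,γ₁,γ₂,γ₃,λ₁,λ₂,μ₁,μ₂,μ₃ be complex parameters such that all q-shifted factorials occurring in denominators are nonzero. With the weights w₁, w₂, w₃ defined in the context, the following limits hold for every fixed i, j, k ∈ ℕ: (i) lim_{r→∞} w₁(r-i, r; q) = ((q^{α₁},q^{μ₁};q)_∞/((q^{γ₁},q^{λ₁};q)_∞)) ((q^{γ₁+λ₁-α₁-μ₁};q)_i/(q;q)_i) q^{iμ₁} ₃φ₁[q^{λ₁-α₁}, q^{γ₁-α₁}, q^{-i}; q^{γ₁+λ₁-α₁-μ₁}; q, q^{α₁-μ₁+i}]; (ii) lim_{s→∞} w₂(s-j, s; q) = ((q^{β₂},q^{μ₂};q)_∞/((q^{γ₂},q^{λ₂};q)_∞)) ((q^{γ₂+λ₂-β₂-μ₂};q)_j/(q;q)_j) q^{jμ₂} ₃φ₁[q^{λ₂-β₂}, q^{γ₂-β₂}, q^{-j}; q^{γ₂+λ₂-β₂-μ₂}; q, q^{β₂-μ₂+j}]; (iii) lim_{t→∞} w₃(t-k, t; q) = ((q^{μ₃};q)_∞/(q^{γ₃};q)_∞)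 ((q^{γ₃-μ₃};q)_k/(q;q)_k) q^{kμ₃}. -/
open Complex

noncomputable section

open Filter Topology

lemma summable_norm_neg_mul_pow {q : ℂ} (hq : ‖q‖ < 1) (a : ℂ) :
    Summable fun j : ℕ => ‖-(a * q ^ j)‖ := by
  simpa [norm_mul, norm_pow] using
    (summable_geometric_of_lt_one (norm_nonneg q) hq).mul_left ‖a‖

/-- `(a;q)ₙ` converges to `(a;q)_∞` for `|q| < 1`. -/
lemma tendsto_qPoch {q : ℂ} (hq : ‖q‖ < 1) (a : ℂ) :
    Tendsto (qPoch q a) atTop (𝓝 (qPochInf q a)) := by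
  have h := (multipliable_one_add_of_summable
    (summable_norm_neg_mul_pow hq a)).tendsto_prod_tprod_nat
  simp only [← sub_eq_add_neg] at h
  exact h

lemma qPoch_self_ne_zero {q : ℂ} (hq : ‖q‖ < 1) (n : ℕ) : qPoch q q n ≠ 0 := by
  refine Finset.prod_ne_zero_iff.mpr fun j _ h => ?_
  have h1 : q ^ (j + 1) = 1 := by rw [pow_succ']; exact (sub_eq_zero.mp h).symm
  have h2 : ‖q‖ ^ (j + 1) < 1 := pow_lt_one₀ (norm_nonneg q) hq j.succ_ne_zero
  rw [← norm_pow, h1, norm_one] at h2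
  exact lt_irrefl _ h2

lemma qPochInf_self_ne_zero {q : ℂ} (hq : ‖q‖ < 1) : qPochInf q q ≠ 0 := by
  have h := tprod_one_add_ne_zero_of_summable (f := fun j : ℕ => -(q * q ^ j)) (fun j => ?_)
    (summable_norm_neg_mul_pow hq q)
  · simp only [← sub_eq_add_neg] at h
    exact h
  · rw [← sub_eq_add_neg]
    exact Finset.prod_ne_zero_iff.mp (qPoch_self_ne_zero hq (j + 1)) j
      (Finset.self_mem_range_succ j)

/-- `(q^{-i};q)ₙ` vanishes for `n > i`. -/
lemma qPoch_cpow_neg_eq_zero {q : ℂ} (hq : q ≠ 0) {i n : ℕ} (h : i < n) :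
    qPoch q (q ^ (-(i : ℂ))) n = 0 := by
  refine Finset.prod_eq_zero (Finset.mem_range.mpr h) ?_
  rw [cpow_neg, cpow_natCast, inv_mul_cancel₀ (pow_ne_zero i hq), sub_self]

lemma prod_neg_inv_pow_mul (q c : ℂ) (n : ℕ) :
    ∏ j ∈ Finset.range n, c / (0 - q ^ j) = ((-1 : ℂ) ^ n * q ^ n.choose 2)⁻¹ * c ^ n := by
  rw [Finset.prod_div_distrib, Finset.prod_const, Finset.card_range, div_eq_inv_mul]
  congr 2
  simp only [zero_sub]
  rw [Finset.prod_neg, Finset.card_range, Finset.prod_pow_eq_pow_sum, Finset.sum_range_id,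
    Nat.choose_two_right]

lemma tendsto_cpow_add_natCast {q : ℂ} (hq0 : q ≠ 0) (hq : ‖q‖ < 1) (c : ℂ) :
    Tendsto (fun r : ℕ => q ^ (c + (r : ℂ))) atTop (𝓝 0) := by
  simp only [cpow_add _ _ hq0, cpow_natCast]
  simpa using (tendsto_pow_atTop_nhds_zero_of_norm_lt_one hq).const_mul (q ^ c)

/-- Confluence of a single factor: `wⁿ / (u;q)ₙ` when `u → ∞` with `w / u` fixed. -/
lemma tendsto_pow_div_qPoch {q : ℂ} (hq0 : q ≠ 0) (hq : ‖q‖ < 1) (a m : ℂ) (i n : ℕ) :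
    Tendsto (fun r : ℕ => (q ^ (1 - ((r : ℂ) - i) - m)) ^ n / qPoch q (q ^ (1 - (r : ℂ) - a)) n)
      atTop (𝓝 (((-1 : ℂ) ^ n * q ^ n.choose 2)⁻¹ * (q ^ (a - m + i)) ^ n)) := by
  rw [← prod_neg_inv_pow_mul]
  have hfac (r : ℕ) : (q ^ (1 - ((r : ℂ) - i) - m)) ^ n / qPoch q (q ^ (1 - (r : ℂ) - a)) n =
      ∏ j ∈ Finset.range n, q ^ (a - m + i) / (q ^ (a - 1 + r) - q ^ j) := by
    rw [qPoch, ← Finset.card_range n, ← Finset.prod_const, Finset.card_range,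
      ← Finset.prod_div_distrib]
    refine Finset.prod_congr rfl fun j _ => ?_
    have hu : q ^ (1 - (r : ℂ) - a) ≠ 0 := by simp [cpow_eq_zero_iff, hq0]
    have h1 : q ^ (1 - ((r : ℂ) - i) - m) = q ^ (1 - (r : ℂ) - a) * q ^ (a - m + i) := by
      rw [← cpow_add _ _ hq0]; ring_nf
    have h2 : q ^ (1 - (r : ℂ) - a) * q ^ (a - 1 + r) = 1 := by
      rw [← cpow_add _ _ hq0]; ring_nf; exact cpow_zero q
    rw [← mul_div_mul_left (q ^ (a - m + i)) _ hu, mul_sub, ← h1, h2]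
  simp only [hfac]
  refine tendsto_finsetProd _ fun j _ => ?_
  refine tendsto_const_nhds.div ((tendsto_cpow_add_natCast hq0 hq _).sub_const _) ?_
  simpa using pow_ne_zero j hq0

/-- Confluence of the terminating `₃φ₂` to a `₃φ₁`. -/
lemma tendsto_phi32 {q : ℂ} (hq0 : q ≠ 0) (hq : ‖q‖ < 1) (a m A B D : ℂ) (i : ℕ) :
    Tendsto (fun r : ℕ => phi32 q A B (q ^ (-(i : ℂ))) D (q ^ (1 - (r : ℂ) - a))
        (q ^ (1 - ((r : ℂ) - i) - m))) atTop
      (𝓝 (phi31 q A B (q ^ (-(i : ℂ))) D (q ^ (a - m + i)))) := by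
  have hvanish (n : ℕ) (hn : n ∉ Finset.range (i + 1)) : qPoch q (q ^ (-(i : ℂ))) n = 0 :=
    qPoch_cpow_neg_eq_zero hq0 (by simpa using hn)
  unfold phi32 phi31
  rw [tsum_eq_sum (s := Finset.range (i + 1)) fun n hn => by simp [hvanish n hn]]
  have hsum (r : ℕ) := tsum_eq_sum (L := SummationFilter.unconditional ℕ)
    (f := fun n : ℕ => qPoch q A n * qPoch q B n * qPoch q (q ^ (-(i : ℂ))) n /
      (qPoch q D n * qPoch q (q ^ (1 - (r : ℂ) - a)) n * qPoch q q n) *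
        (q ^ (1 - ((r : ℂ) - i) - m)) ^ n)
    (s := Finset.range (i + 1)) fun n hn => by simp [hvanish n hn]
  simp only [hsum]
  refine tendsto_finsetSum _ fun n _ => ?_
  have h := (tendsto_pow_div_qPoch hq0 hq a m i n).const_mul
    (qPoch q A n * qPoch q B n * qPoch q (q ^ (-(i : ℂ))) n / (qPoch q D n * qPoch q q n))
  rw [← mul_assoc] at h
  refine h.congr fun r => ?_
  simp only [div_eq_mul_inv, mul_inv]
  ring

lemma tendsto_qPoch_sub {q : ℂ} (hq : ‖q‖ < 1) (a : ℂ) (i : ℕ) :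
    Tendsto (fun r : ℕ => qPoch q a (r - i)) atTop (𝓝 (qPochInf q a)) :=
  (tendsto_qPoch hq a).comp (tendsto_sub_atTop_nat i)

lemma tendsto_wgt {q : ℂ} (hq0 : q ≠ 0) (hq : ‖q‖ < 1) {a g l m : ℂ}
    (hg : qPochInf q (q ^ g) ≠ 0) (hl : qPochInf q (q ^ l) ≠ 0) (i : ℕ) :
    Tendsto (fun r : ℕ => wgt q a g l m (r - i) r) atTop
      (𝓝 (qPochInf q (q ^ a) * qPochInf q (q ^ m) / (qPochInf q (q ^ g) * qPochInf q (q ^ l)) *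
        (qPoch q (q ^ (g + l - a - m)) i / qPoch q q i) * q ^ ((i : ℂ) * m) *
        phi31 q (q ^ (l - a)) (q ^ (g - a)) (q ^ (-(i : ℂ))) (q ^ (g + l - a - m))
          (q ^ (a - m + i)))) := by
  have hqq := qPochInf_self_ne_zero hq
  have h := ((((((tendsto_qPoch hq (q ^ a)).mul (tendsto_qPoch hq q)).div
    ((tendsto_qPoch hq (q ^ g)).mul (tendsto_qPoch hq (q ^ l))) (mul_ne_zero hg hl)).mul_const
    (qPoch q (q ^ (g + l - a - m)) i / qPoch q q i)).mul
    ((tendsto_qPoch_sub hq (q ^ m) i).div (tendsto_qPoch_sub hq q i) hqq)).mul_const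
    (q ^ ((i : ℂ) * m))).mul
    (tendsto_phi32 hq0 hq a m (q ^ (l - a)) (q ^ (g - a)) (q ^ (g + l - a - m)) i)
  refine (h.congr' ?_).trans_eq ?_
  · filter_upwards [eventually_ge_atTop i] with r hr
    have hc : ((r - i : ℕ) : ℂ) = (r : ℂ) - i := Nat.cast_sub hr
    rw [wgt, Nat.sub_sub_self hr, hc, sub_sub_cancel_left]
    rfl
  · congr 3
    field_simp

lemma tendsto_wgt3 {q : ℂ} (hq : ‖q‖ < 1) {g m : ℂ} (hg : qPochInf q (q ^ g) ≠ 0) (k : ℕ) :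
    Tendsto (fun t : ℕ => wgt3 q g m (t - k) t) atTop
      (𝓝 (qPochInf q (q ^ m) / qPochInf q (q ^ g) *
        (qPoch q (q ^ (g - m)) k / qPoch q q k) * q ^ ((k : ℂ) * m))) := by
  have hqq := qPochInf_self_ne_zero hq
  have h := ((((tendsto_qPoch hq q).div (tendsto_qPoch hq (q ^ g)) hg).mul_const
    (qPoch q (q ^ (g - m)) k / qPoch q q k)).mul
    ((tendsto_qPoch_sub hq (q ^ m) k).div (tendsto_qPoch_sub hq q k) hqq)).mul_const
    (q ^ ((k : ℂ) * m))
  refine (h.congr' ?_).trans_eq ?_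
  · filter_upwards [eventually_ge_atTop k] with t ht
    rw [wgt3, Nat.sub_sub_self ht]
    rfl
  · congr 2
    field_simp

/-- The limits (4.17)–(4.19) of the weights `w₁`, `w₂`, `w₃`. -/
theorem weight_limits
    (q : ℝ) (hq0 : 0 < q) (hq1 : q < 1)
    (α₁ β₂ γ₁ γ₂ γ₃ Λ₁ Λ₂ μ₁ μ₂ μ₃ : ℂ)
    (hden : ∀ n : ℕ,
      qPoch (q : ℂ) ((q : ℂ) ^ γ₁) n ≠ 0 ∧ qPoch (q : ℂ) ((q : ℂ) ^ γ₂) n ≠ 0 ∧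
      qPoch (q : ℂ) ((q : ℂ) ^ γ₃) n ≠ 0 ∧
      qPoch (q : ℂ) ((q : ℂ) ^ Λ₁) n ≠ 0 ∧ qPoch (q : ℂ) ((q : ℂ) ^ Λ₂) n ≠ 0 ∧
      qPoch (q : ℂ) ((q : ℂ) ^ (γ₁ + Λ₁ - α₁ - μ₁)) n ≠ 0 ∧
      qPoch (q : ℂ) ((q : ℂ) ^ (γ₂ + Λ₂ - β₂ - μ₂)) n ≠ 0)
    (hdenr : ∀ r n : ℕ, qPoch (q : ℂ) ((q : ℂ) ^ (1 - (r : ℂ) - α₁)) n ≠ 0)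
    (hdens : ∀ s n : ℕ, qPoch (q : ℂ) ((q : ℂ) ^ (1 - (s : ℂ) - β₂)) n ≠ 0)
    (hinf : qPochInf (q : ℂ) ((q : ℂ) ^ γ₁) ≠ 0 ∧
      qPochInf (q : ℂ) ((q : ℂ) ^ γ₂) ≠ 0 ∧ qPochInf (q : ℂ) ((q : ℂ) ^ γ₃) ≠ 0 ∧
      qPochInf (q : ℂ) ((q : ℂ) ^ Λ₁) ≠ 0 ∧ qPochInf (q : ℂ) ((q : ℂ) ^ Λ₂) ≠ 0)
    (i j k : ℕ) :
    Filter.Tendsto (fun r : ℕ => wgt (q : ℂ) α₁ γ₁ Λ₁ μ₁ (r - i) r) Filter.atTop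
      (nhds (qPochInf (q : ℂ) ((q : ℂ) ^ α₁) * qPochInf (q : ℂ) ((q : ℂ) ^ μ₁) /
        (qPochInf (q : ℂ) ((q : ℂ) ^ γ₁) * qPochInf (q : ℂ) ((q : ℂ) ^ Λ₁)) *
        (qPoch (q : ℂ) ((q : ℂ) ^ (γ₁ + Λ₁ - α₁ - μ₁)) i / qPoch (q : ℂ) (q : ℂ) i) *
        (q : ℂ) ^ ((i : ℂ) * μ₁) *
        phi31 (q : ℂ) ((q : ℂ) ^ (Λ₁ - α₁)) ((q : ℂ) ^ (γ₁ - α₁))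
          ((q : ℂ) ^ (-(i : ℂ))) ((q : ℂ) ^ (γ₁ + Λ₁ - α₁ - μ₁))
          ((q : ℂ) ^ (α₁ - μ₁ + i)))) ∧
    Filter.Tendsto (fun s : ℕ => wgt (q : ℂ) β₂ γ₂ Λ₂ μ₂ (s - j) s) Filter.atTop
      (nhds (qPochInf (q : ℂ) ((q : ℂ) ^ β₂) * qPochInf (q : ℂ) ((q : ℂ) ^ μ₂) /
        (qPochInf (q : ℂ) ((q : ℂ) ^ γ₂) * qPochInf (q : ℂ) ((q : ℂ) ^ Λ₂)) *
        (qPoch (q : ℂ) ((q : ℂ) ^ (γ₂ + Λ₂ - β₂ - μ₂)) j / qPoch (q : ℂ) (q : ℂ) j) *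
        (q : ℂ) ^ ((j : ℂ) * μ₂) *
        phi31 (q : ℂ) ((q : ℂ) ^ (Λ₂ - β₂)) ((q : ℂ) ^ (γ₂ - β₂))
          ((q : ℂ) ^ (-(j : ℂ))) ((q : ℂ) ^ (γ₂ + Λ₂ - β₂ - μ₂))
          ((q : ℂ) ^ (β₂ - μ₂ + j)))) ∧
    Filter.Tendsto (fun t : ℕ => wgt3 (q : ℂ) γ₃ μ₃ (t - k) t) Filter.atTop
      (nhds (qPochInf (q : ℂ) ((q : ℂ) ^ μ₃) / qPochInf (q : ℂ) ((q : ℂ) ^ γ₃) *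
        (qPoch (q : ℂ) ((q : ℂ) ^ (γ₃ - μ₃)) k / qPoch (q : ℂ) (q : ℂ) k) *
        (q : ℂ) ^ ((k : ℂ) * μ₃))) := by
  have hq : (q : ℂ) ≠ 0 := ofReal_ne_zero.mpr hq0.ne'
  have hq' : ‖(q : ℂ)‖ < 1 := by rwa [norm_real, Real.norm_of_nonneg hq0.le]
  obtain ⟨hγ₁, hγ₂, hγ₃, hΛ₁, hΛ₂⟩ := hinf
  exact ⟨tendsto_wgt hq hq' hγ₁ hΛ₁ i, tendsto_wgt hq hq' hγ₂ hΛ₂ j, tendsto_wgt3 hq' hγ₃ k⟩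
end
end
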